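/- arXiv:0809.2240 — 4 statements merged into one kernel-verified Lean document; each statement's English description precedes it below -/
import Mathlib

section
/- Let G be a group, and let H and K be subgroups of G such that every element of K normalizes H. Assume K is 2-divisible, i.e., every element of K is the square of some element of K. Suppose there is an involution i in G that inverts K (i*k*i⁻¹ = k⁻¹ for every k in K) and that either centralizes H (i*h*i⁻¹ = h for every h in H) or inverts H (i*h*i⁻¹ = h⁻¹ for every h in H). Then [H,K] = 1, that is, every element of H commutes with every element of K. -/
theorem commute_sq_of_conj_inv_eq_conj {G : Type*} [Group G] {h k : G}
    (e : k⁻¹ * h * k = k * h * k⁻¹) : Commute h (k ^ 2) := by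
  calc h * k ^ 2 = k * (k⁻¹ * h * k) * k := by rw [pow_two]; group
    _ = k * (k * h * k⁻¹) * k := by rw [e]
    _ = k ^ 2 * h := by rw [pow_two]; group

/-- Fact 3.1 (Deloro): if a 2-divisible subgroup `K` normalizes `H`, and an involution `i`
inverts `K` and centralizes or inverts `H`, then `[H, K] = 1`. -/
theorem stmt0 {G : Type*} [Group G] (H K : Subgroup G)
    (hnorm : ∀ k ∈ K, ∀ h ∈ H, k⁻¹ * h * k ∈ H)
    (hdiv : ∀ k ∈ K, ∃ k' ∈ K, k' ^ 2 = k)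
    (i : G) (hi2 : i ^ 2 = 1) (hi1 : i ≠ 1)
    (hinvK : ∀ k ∈ K, i * k * i⁻¹ = k⁻¹)
    (hH : (∀ h ∈ H, i * h * i⁻¹ = h) ∨ (∀ h ∈ H, i * h * i⁻¹ = h⁻¹)) :
    ∀ h ∈ H, ∀ k ∈ K, h * k = k * h := by
  intro h hh k hkK
  obtain ⟨k, hk, rfl⟩ := hdiv k hkK
  have hconj : i * (k⁻¹ * h * k) * i⁻¹ = k * (i * h * i⁻¹) * k⁻¹ := by
    calc i * (k⁻¹ * h * k) * i⁻¹
        = (i * k * i⁻¹)⁻¹ * (i * h * i⁻¹) * (i * k * i⁻¹) := by group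
      _ = k * (i * h * i⁻¹) * k⁻¹ := by rw [hinvK k hk, inv_inv]
  apply commute_sq_of_conj_inv_eq_conj
  rcases hH with hH | hH
  · rwa [hH _ (hnorm k hk h hh), hH h hh] at hconj
  · rw [hH _ (hnorm k hk h hh), hH h hh] at hconj
    apply inv_injective
    rw [hconj]
    group
end

section
/- Let G be a group and α an automorphism of G. Suppose a, b, x, y are elements of G with α(a) = a, α(b) = b, α(x) = x⁻¹, α(y) = y⁻¹, and a*x = b*y. Then x² = y² and y inverts a⁻¹*b, i.e., y⁻¹*(a⁻¹*b)*y = (a⁻¹*b)⁻¹. -/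
/-- If an automorphism `α` fixes `a, b` and inverts `x, y`, and `a*x = b*y`,
then `x² = y²` and `y` inverts `a⁻¹*b`. -/
theorem stmt3 {G : Type*} [Group G] (α : G ≃* G) (a b x y : G)
    (ha : α a = a) (hb : α b = b) (hx : α x = x⁻¹) (hy : α y = y⁻¹)
    (h : a * x = b * y) :
    x ^ 2 = y ^ 2 ∧ y⁻¹ * (a⁻¹ * b) * y = (a⁻¹ * b)⁻¹ := by
  have h' : a * x⁻¹ = b * y⁻¹ := by
    simpa only [map_mul, ha, hb, hx, hy] using congrArg α h
  have h₁ : a⁻¹ * b = x * y⁻¹ := by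
    rw [eq_mul_inv_iff_mul_eq, mul_assoc, ← h, inv_mul_cancel_left]
  have h₂ : a⁻¹ * b = x⁻¹ * y := by
    rw [← mul_inv_eq_iff_eq_mul, mul_assoc, ← h', inv_mul_cancel_left]
  constructor
  · have h₃ : x * y⁻¹ = x⁻¹ * y := h₁.symm.trans h₂
    rw [mul_inv_eq_iff_eq_mul, mul_assoc, eq_inv_mul_iff_mul_eq] at h₃
    rw [pow_two, pow_two, h₃]
  · calc y⁻¹ * (a⁻¹ * b) * y = y⁻¹ * x := by rw [h₁]; group
      _ = (a⁻¹ * b)⁻¹ := by rw [h₂]; group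
end

section
/- Let G be a group, j an element of G with j² = 1, F a subgroup of G, and U a normal subgroup of G such that U is contained in F and every element of U commutes with every element of F. Assume that every element of G can be written as c*f with c in the centralizer of j in G and f in F. Then the set {u ∈ U : j*u*j = u⁻¹} is a normal subgroup of G. -/
/-- If `U ≤ F` is normal in `G`, centralized by `F`, `j² = 1`, and `G = C(j)·F`, then
the set of elements of `U` inverted by `j` is a normal subgroup of `G`. -/
theorem stmt4 {G : Type*} [Group G] (j : G) (hj : j ^ 2 = 1)
    (F U : Subgroup G) (hUnormal : U.Normal) (hUF : U ≤ F)
    (hcomm : ∀ u ∈ U, ∀ f ∈ F, u * f = f * u)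
    (hdecomp : ∀ g : G, ∃ c ∈ Subgroup.centralizer {j}, ∃ f ∈ F, g = c * f) :
    ∃ N : Subgroup G,
      ((N : Set G) = {u : G | u ∈ U ∧ j * u * j = u⁻¹}) ∧ N.Normal := by
  have hjj : j * j = 1 := by rw [← sq, hj]
  refine ⟨{ carrier := {u : G | u ∈ U ∧ j * u * j = u⁻¹}
            mul_mem' := ?_, one_mem' := ⟨U.one_mem, by simpa using hjj⟩
            inv_mem' := ?_ }, rfl, ⟨?_⟩⟩
  · rintro a b ⟨ha, hja⟩ ⟨hb, hjb⟩
    refine ⟨U.mul_mem ha hb, ?_⟩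
    calc j * (a * b) * j = j * a * (j * j) * b * j := by rw [hjj]; group
      _ = (j * a * j) * (j * b * j) := by group
      _ = (b * a)⁻¹ := by rw [hja, hjb, mul_inv_rev]
      _ = (a * b)⁻¹ := by rw [hcomm a ha b (hUF hb)]
  · rintro a ⟨ha, hja⟩
    refine ⟨U.inv_mem ha, ?_⟩
    calc j * a⁻¹ * j = (j * j) * a * (j * j) := by rw [← hja]; group
      _ = a⁻¹⁻¹ := by rw [hjj]; group
  · rintro u ⟨hu, hju⟩ g
    refine ⟨hUnormal.conj_mem u hu g, ?_⟩
    obtain ⟨c, hc, f, hf, rfl⟩ := hdecomp g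
    have hcj : j * c = c * j := Subgroup.mem_centralizer_singleton_iff.mp hc |>.symm
    have hcj' : c⁻¹ * j = j * c⁻¹ := by
      rw [inv_mul_eq_iff_eq_mul, ← mul_assoc, ← hcj, mul_inv_cancel_right]
    have hconj : c * f * u * (c * f)⁻¹ = c * u * c⁻¹ := by
      rw [mul_assoc c f u, ← hcomm u hu f hf]
      group
    rw [hconj]
    calc j * (c * u * c⁻¹) * j = (j * c) * u * (c⁻¹ * j) := by group
      _ = c * (j * u * j) * c⁻¹ := by rw [hcj, hcj']; group
      _ = (c * u * c⁻¹)⁻¹ := by rw [hju]; group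
end

section
/- Let G be a finite group, p a prime, H a subgroup of G, K a p-subgroup of G such that every element of K normalizes H, and S a Sylow p-subgroup of H. Then there exists γ ∈ H such that the conjugate γ⁻¹*K*γ normalizes S, i.e., for every k ∈ K and s ∈ S, (γ⁻¹*k*γ)⁻¹*s*(γ⁻¹*k*γ) ∈ S. -/
/-- A `p`-group acting by automorphisms on a finite group fixes a Sylow `p`-subgroup. -/
theorem IsPGroup.exists_sylow_forall_smul_eq {p : ℕ} [Fact p.Prime] {A H : Type*} [Group A]
    [Group H] [Finite H] [MulDistribMulAction A H] (hA : IsPGroup p A) :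
    ∃ P : Sylow p H, ∀ a : A, a • P = P :=
  hA.nonempty_fixed_point_of_prime_not_dvd_card (Sylow p H) (not_dvd_card_sylow p H)

/-- If a `p`-subgroup `K` of a finite group `G` normalizes a subgroup `H`, and `S` is a
Sylow `p`-subgroup of `H` (a maximal `p`-subgroup of `H`), then some `H`-conjugate of `K`
normalizes `S`. -/
theorem stmt6 {G : Type*} [Group G] [Finite G] (p : ℕ) (hp : p.Prime)
    (H K S : Subgroup G)
    (hK : IsPGroup p K)
    (hKH : ∀ k ∈ K, ∀ h ∈ H, k⁻¹ * h * k ∈ H)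
    (hSH : S ≤ H) (hSp : IsPGroup p S)
    (hSmax : ∀ Q : Subgroup G, Q ≤ H → IsPGroup p Q → S ≤ Q → Q = S) :
    ∃ γ ∈ H, ∀ k ∈ K, ∀ s ∈ S, (γ⁻¹ * k * γ)⁻¹ * s * (γ⁻¹ * k * γ) ∈ S := by
  have : Fact p.Prime := ⟨hp⟩
  have hKN : K ≤ Subgroup.normalizer (H : Set G) := fun k hk => by
    refine Subgroup.mem_normalizer_iff.2 fun h => ⟨fun hh => ?_, fun hh => ?_⟩
    · simpa using hKH k⁻¹ (K.inv_mem hk) h hh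
    · simpa [mul_assoc] using hKH k hk _ hh
  let T : Sylow p H :=
    { S.subgroupOf H with
      isPGroup' := hSp.comap_subtype
      is_maximal' := fun {Q} hQ hle => by
        have hmap : Q.map H.subtype = S := by
          refine hSmax _ (Subgroup.map_subtype_le Q) (hQ.map _) fun s hs => ?_
          exact ⟨⟨s, hSH hs⟩, hle hs, rfl⟩
        ext x
        change x ∈ Q ↔ (x : G) ∈ S
        simp [← hmap] }
  let _ : MulDistribMulAction K H :=
    MulDistribMulAction.compHom H (H.normalizerMonoidHom.comp (Subgroup.inclusion hKN))
  obtain ⟨P, hP⟩ := hK.exists_sylow_forall_smul_eq (H := H)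
  obtain ⟨γ, rfl⟩ := MulAction.exists_smul_eq H T P
  refine ⟨γ, γ.2, fun k hk s hs => ?_⟩
  let t : H := ⟨s, hSH hs⟩
  have ht : t ∈ T := hs
  have hγt : MulAut.conj γ • t ∈ γ • T := Subgroup.smul_mem_pointwise_smul t _ T.toSubgroup ht
  have hmem : (⟨k, hk⟩⁻¹ : K) • MulAut.conj γ • t ∈ γ • T := by
    rw [← hP (⟨k, hk⟩⁻¹ : K)]
    exact Subgroup.smul_mem_pointwise_smul _ _ (γ • T).toSubgroup hγt
  have hinv : (MulAut.conj γ)⁻¹ • (⟨k, hk⟩⁻¹ : K) • MulAut.conj γ • t ∈ T :=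
    Subgroup.mem_pointwise_smul_iff_inv_smul_mem.1 hmem
  have hcoe : (((MulAut.conj γ)⁻¹ • (⟨k, hk⟩⁻¹ : K) • MulAut.conj γ • t : H) : G) =
      γ⁻¹ * (k⁻¹ * (γ * s * γ⁻¹) * k⁻¹⁻¹) * γ := rfl
  have hS : (γ : G)⁻¹ * (k⁻¹ * (γ * s * γ⁻¹) * k⁻¹⁻¹) * γ ∈ S := hcoe ▸ hinv
  simpa [mul_assoc] using hS
end
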